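/- For a multipartite quantum state ensemble E = {(η_i, ρ_i)}_{i=1}^n and each j ∈ {1,...,n}: Q_j(E) < C_j(E) if and only if there exists a real number r ∈ (0,1) such that p_SEP(E_j^r) = r < p_G(E_j^r), where E_j^r = {(r, ρ_0), (1−r, ρ_j)} is the two-state ensemble consisting of ρ_0 = Σ_i η_i ρ_i with probability r and ρ_j with probability 1−r. -/

import Mathlib

open ComplexOrder

/-- The product operator `σ 1 ⊗ ⋯ ⊗ σ m` on the multipartite space
`⨂ k, ℂ^(d k)`, realized as a matrix indexed by tuples. -/
noncomputable def prodMat {m : ℕ} (d : Fin m → ℕ)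
    (σ : ∀ k : Fin m, Matrix (Fin (d k)) (Fin (d k)) ℂ) :
    Matrix (∀ k, Fin (d k)) (∀ k, Fin (d k)) ℂ :=
  Matrix.of fun x y => ∏ k, σ k (x k) (y k)

/-- A density matrix: positive semidefinite with unit trace. -/
def IsState {ι : Type*} [Fintype ι] (ρ : Matrix ι ι ℂ) : Prop :=
  ρ.PosSemidef ∧ ρ.trace = 1

/-- A separable operator: a conic combination of product states. -/
def IsSep {m : ℕ} {d : Fin m → ℕ}
    (E : Matrix (∀ k, Fin (d k)) (∀ k, Fin (d k)) ℂ) : Prop :=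
  ∃ (L : ℕ) (p : Fin L → ℝ)
    (σ : Fin L → ∀ k : Fin m, Matrix (Fin (d k)) (Fin (d k)) ℂ),
    (∀ l, 0 ≤ p l) ∧ (∀ l k, IsState (σ l k)) ∧
    E = ∑ l, (p l : ℂ) • prodMat d (σ l)

/-- A block-positive Hermitian operator: `Tr (E * F) ≥ 0` for every separable `F`. -/
def IsBlockPos {m : ℕ} {d : Fin m → ℕ}
    (E : Matrix (∀ k, Fin (d k)) (∀ k, Fin (d k)) ℂ) : Prop :=
  E.IsHermitian ∧ ∀ F, IsSep F → 0 ≤ (E * F).trace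

open Matrix

section PositiveSemidefinite

variable {ι : Type*} [Fintype ι] [DecidableEq ι]

open scoped Matrix.Norms.L2Operator MatrixOrder in
/-- The set of measurements with outcomes in `κ` is compact. -/
theorem isCompact_setOf_posSemidef_sum_eq_one {κ : Type*} [Fintype κ] :
    IsCompact {M : κ → Matrix ι ι ℂ | (∀ i, (M i).PosSemidef) ∧ ∑ i, M i = 1} := by
  refine IsCompact.of_isClosed_subset
    (isCompact_univ_pi fun _ : κ => isCompact_closedBall (0 : Matrix ι ι ℂ) 1) ?_ ?_
  · simp only [Set.ofPred_and, Set.ofPred_forall, ← Matrix.nonneg_iff_posSemidef]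
    refine IsClosed.inter (isClosed_iInter fun i => ?_) ?_
    · exact (CStarAlgebra.isClosed_nonneg (A := Matrix ι ι ℂ)).preimage
        (continuous_apply (A := fun _ : κ => Matrix ι ι ℂ) i)
    · exact isClosed_eq (by fun_prop) continuous_const
  · rintro M ⟨hM, hsum⟩ i -
    have hM' : ∀ i, 0 ≤ M i := fun i => (hM i).nonneg
    rw [mem_closedBall_zero_iff, CStarAlgebra.norm_le_one_iff_of_nonneg _ (hM' i), ← hsum]
    exact Finset.single_le_sum (fun i _ => hM' i) (Finset.mem_univ i)

open scoped MatrixOrder in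
theorem Matrix.PosSemidef.exists_eq_conjTranspose_mul_self {A : Matrix ι ι ℂ}
    (hA : A.PosSemidef) : ∃ B : Matrix ι ι ℂ, A = Bᴴ * B :=
  CStarAlgebra.nonneg_iff_eq_star_mul_self.mp hA.nonneg

theorem Matrix.PosSemidef.trace_mul_nonneg {A B : Matrix ι ι ℂ}
    (hA : A.PosSemidef) (hB : B.PosSemidef) : 0 ≤ (A * B).trace := by
  obtain ⟨C, rfl⟩ := hB.exists_eq_conjTranspose_mul_self
  rw [← Matrix.mul_assoc, Matrix.trace_mul_comm, ← Matrix.mul_assoc]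
  exact (hA.mul_mul_conjTranspose_same C).trace_nonneg

open scoped MatrixOrder in
theorem IsState.posSemidef_one_sub {σ : Matrix ι ι ℂ} (hσ : IsState σ) :
    (1 - σ).PosSemidef := by
  have hH := hσ.1.isHermitian
  have hsum : ∑ i, hH.eigenvalues i = 1 := by
    have h := hH.trace_eq_sum_eigenvalues
    rw [hσ.2] at h
    exact Complex.ofReal_injective (by simpa using h.symm)
  refine le_iff.mp (CFC.le_one (R := ℝ) (a := σ) fun x hx => ?_)
  obtain ⟨i, rfl⟩ := hH.spectrum_real_eq_range_eigenvalues ▸ hx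
  exact hsum ▸ Finset.single_le_sum (fun i _ => hσ.1.eigenvalues_nonneg i) (Finset.mem_univ i)

theorem Matrix.PosSemidef.exists_isState [Nonempty ι] {A : Matrix ι ι ℂ} (hA : A.PosSemidef) :
    ∃ (c : ℝ) (σ : Matrix ι ι ℂ), 0 ≤ c ∧ IsState σ ∧ A = (c : ℂ) • σ := by
  have hre : ((A.trace.re : ℝ) : ℂ) = A.trace :=
    (Complex.eq_re_of_ofReal_le (r := 0) (by simpa using hA.trace_nonneg)).symm
  have hnn : 0 ≤ A.trace.re := (Complex.nonneg_iff.mp hA.trace_nonneg).1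
  by_cases h0 : A.trace = 0
  · obtain ⟨i⟩ := ‹Nonempty ι›
    refine ⟨0, Matrix.diagonal (Pi.single i 1), le_rfl, ⟨?_, by simp⟩, ?_⟩
    · refine .diagonal fun k => ?_
      by_cases h : k = i
      · subst h; simp
      · simp [h]
    · simp [hA.trace_eq_zero_iff.mp h0]
  · refine ⟨A.trace.re, ((A.trace.re⁻¹ : ℝ) : ℂ) • A, hnn, ⟨?_, ?_⟩, ?_⟩
    · exact hA.smul (by exact_mod_cast inv_nonneg.mpr hnn)
    · simp [hre, h0]
    · simp [hre, smul_smul, h0]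

theorem Matrix.IsHermitian.exists_isState_trace_mul_neg {A : Matrix ι ι ℂ} (hA : A.IsHermitian)
    (h : ¬ A.PosSemidef) : ∃ σ, IsState σ ∧ (A * σ).trace.re < 0 := by
  obtain ⟨x, hx⟩ : ∃ x : ι → ℂ, ¬ 0 ≤ star x ⬝ᵥ (A *ᵥ x) := by
    by_contra! hx
    exact h (.of_dotProduct_mulVec_nonneg hA hx)
  have hneg : (A * vecMulVec x (star x)).trace.re < 0 := by
    rw [mul_vecMulVec, trace_vecMulVec, dotProduct_comm]
    by_contra! hre
    exact hx (Complex.nonneg_iff.mpr ⟨hre, (hA.im_star_dotProduct_mulVec_self x).symm⟩)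
  have : Nonempty ι := by
    by_contra hι
    rw [not_nonempty_iff] at hι
    simp [trace] at hneg
  obtain ⟨c, σ, hc, hσ, hcσ⟩ := (posSemidef_vecMulVec_self_star x).exists_isState
  refine ⟨σ, hσ, ?_⟩
  rw [hcσ, mul_smul_comm, trace_smul, smul_eq_mul, Complex.re_ofReal_mul] at hneg
  exact neg_of_mul_neg_right hneg hc

end PositiveSemidefinite

section Separable

variable {m : ℕ} {d : Fin m → ℕ}

theorem IsSep.zero : IsSep (0 : Matrix (∀ k, Fin (d k)) (∀ k, Fin (d k)) ℂ) :=
  ⟨0, Fin.elim0, fun l => l.elim0, fun l => l.elim0, fun l => l.elim0, by simp⟩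

theorem IsSep.add {E F : Matrix (∀ k, Fin (d k)) (∀ k, Fin (d k)) ℂ} (hE : IsSep E)
    (hF : IsSep F) : IsSep (E + F) := by
  obtain ⟨L, p, σ, hp, hσ, rfl⟩ := hE
  obtain ⟨L', p', σ', hp', hσ', rfl⟩ := hF
  refine ⟨L + L', Fin.append p p', Fin.append σ σ', fun l => ?_, fun l => ?_, ?_⟩
  · induction l using Fin.addCases <;> simp [hp, hp']
  · induction l using Fin.addCases <;> simp [hσ, hσ']
  · simp [Fin.sum_univ_add]

theorem IsSep.sum {α : Type*} (s : Finset α)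
    {f : α → Matrix (∀ k, Fin (d k)) (∀ k, Fin (d k)) ℂ}
    (hf : ∀ a ∈ s, IsSep (f a)) : IsSep (∑ a ∈ s, f a) :=
  Finset.sum_induction f IsSep (fun _ _ => IsSep.add) IsSep.zero hf

theorem isSep_prodMat (hd : ∀ k, 0 < d k) {τ : ∀ k, Matrix (Fin (d k)) (Fin (d k)) ℂ}
    (hτ : ∀ k, (τ k).PosSemidef) : IsSep (prodMat d τ) := by
  have : ∀ k, Nonempty (Fin (d k)) := fun k => ⟨⟨0, hd k⟩⟩
  choose c σ hc hσ h using fun k => (hτ k).exists_isState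
  refine ⟨1, fun _ => ∏ k, c k, fun _ => σ, fun _ => Finset.prod_nonneg fun k _ => hc k,
    fun _ => hσ, ?_⟩
  ext x y
  simp [prodMat, h, Finset.prod_mul_distrib]

theorem prodMat_one : prodMat d (fun _ => 1) = 1 := by
  ext x y
  simp [prodMat, one_apply, Finset.prod_ite_zero, funext_iff]

theorem prodMat_mul (σ τ : ∀ k, Matrix (Fin (d k)) (Fin (d k)) ℂ) :
    prodMat d (fun k => σ k * τ k) = prodMat d σ * prodMat d τ := by
  ext x y
  simp [prodMat, mul_apply, Finset.prod_univ_sum, Finset.prod_mul_distrib]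

theorem prodMat_conjTranspose (σ : ∀ k, Matrix (Fin (d k)) (Fin (d k)) ℂ) :
    prodMat d (fun k => (σ k)ᴴ) = (prodMat d σ)ᴴ := by
  ext x y
  simp [prodMat]

theorem prodMat_add (σ τ : ∀ k, Matrix (Fin (d k)) (Fin (d k)) ℂ) :
    prodMat d (fun k => σ k + τ k) =
      ∑ s : Finset (Fin m), prodMat d (s.piecewise σ τ) := by
  ext x y
  simp only [prodMat, of_apply, Matrix.add_apply, Matrix.sum_apply, Fintype.prod_add]
  refine Finset.sum_congr rfl fun s _ => ?_
  rw [← Finset.prod_mul_prod_compl s fun k => s.piecewise σ τ k (x k) (y k)]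
  congr 1 <;> refine Finset.prod_congr rfl fun k hk => ?_
  · simp [hk]
  · rw [s.piecewise_eq_of_notMem _ _ (Finset.mem_compl.mp hk)]

theorem posSemidef_prodMat {σ : ∀ k, Matrix (Fin (d k)) (Fin (d k)) ℂ}
    (hσ : ∀ k, (σ k).PosSemidef) : (prodMat d σ).PosSemidef := by
  choose B hB using fun k => (hσ k).exists_eq_conjTranspose_mul_self
  obtain rfl : σ = fun k => (B k)ᴴ * B k := funext hB
  rw [prodMat_mul, prodMat_conjTranspose]
  exact posSemidef_conjTranspose_mul_self _

theorem IsSep.posSemidef {E : Matrix (∀ k, Fin (d k)) (∀ k, Fin (d k)) ℂ} (hE : IsSep E) :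
    E.PosSemidef := by
  obtain ⟨L, p, σ, hp, hσ, rfl⟩ := hE
  exact posSemidef_sum _ fun l _ =>
    (posSemidef_prodMat fun k => (hσ l k).1).smul (by exact_mod_cast hp l)

theorem isSep_one (hd : ∀ k, 0 < d k) :
    IsSep (1 : Matrix (∀ k, Fin (d k)) (∀ k, Fin (d k)) ℂ) :=
  prodMat_one (d := d) ▸ isSep_prodMat hd fun _ => .one

/-- The complement of a product state is separable. -/
theorem isSep_one_sub_prodMat (hd : ∀ k, 0 < d k)
    {σ : ∀ k, Matrix (Fin (d k)) (Fin (d k)) ℂ} (hσ : ∀ k, IsState (σ k)) :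
    IsSep (1 - prodMat d σ) := by
  have h : 1 - prodMat d σ = ∑ s ∈ Finset.univ.erase (Finset.univ : Finset (Fin m)),
      prodMat d (s.piecewise σ fun k => 1 - σ k) := by
    have h1 := prodMat_add σ fun k => 1 - σ k
    rw [← Finset.add_sum_erase _ _ (Finset.mem_univ Finset.univ), Finset.piecewise_univ] at h1
    rw [sub_eq_iff_eq_add', ← h1, ← prodMat_one]
    simp
  rw [h]
  refine IsSep.sum _ fun s _ => isSep_prodMat hd fun k => ?_
  by_cases hk : k ∈ s
  · simpa [hk] using (hσ k).1
  · simpa [hk] using (hσ k).posSemidef_one_sub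

/-- Block positivity need only be tested on product states. -/
theorem isBlockPos_of_prodMat {A : Matrix (∀ k, Fin (d k)) (∀ k, Fin (d k)) ℂ}
    (hA : A.IsHermitian)
    (h : ∀ σ : ∀ k, Matrix (Fin (d k)) (Fin (d k)) ℂ, (∀ k, IsState (σ k)) →
      0 ≤ (A * prodMat d σ).trace.re) : IsBlockPos A := by
  refine ⟨hA, ?_⟩
  rintro F hF
  have him : (A * F).trace.im = 0 := by
    rw [← Complex.conj_eq_iff_im, starRingEnd_apply, ← trace_conjTranspose, conjTranspose_mul,
      hA.eq, hF.posSemidef.isHermitian.eq, trace_mul_comm]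
  refine Complex.nonneg_iff.mpr ⟨?_, him.symm⟩
  obtain ⟨L, p, σ, hp, hσ, rfl⟩ := hF
  rw [Matrix.mul_sum, trace_sum, Complex.re_sum]
  refine Finset.sum_nonneg fun l _ => ?_
  rw [mul_smul_comm, trace_smul, smul_eq_mul, Complex.re_ofReal_mul]
  exact mul_nonneg (hp l) (h _ (hσ l))

theorem IsBlockPos.smul {A : Matrix (∀ k, Fin (d k)) (∀ k, Fin (d k)) ℂ} (hA : IsBlockPos A)
    {c : ℝ} (hc : 0 ≤ c) : IsBlockPos ((c : ℂ) • A) := by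
  refine ⟨hA.1.smul (by simp [IsSelfAdjoint]), fun F hF => ?_⟩
  rw [smul_mul_assoc, trace_smul, smul_eq_mul]
  exact mul_nonneg (by exact_mod_cast hc) (hA.2 F hF)

end Separable

section TwoStateDiscrimination

variable {ι : Type*} [Fintype ι] [DecidableEq ι]

/-- The success probability of a measurement that discriminates two states. -/
theorem guessing_value_eq {ρ₀ ρ₁ : Matrix ι ι ℂ} (h₀ : ρ₀.trace = 1) (r : ℝ)
    {M : Fin 3 → Matrix ι ι ℂ} (hM : ∑ i, M i = 1) :
    r * (ρ₀ * M 1).trace.re + (1 - r) * (ρ₁ * M 2).trace.re =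
      r - r * (ρ₀ * M 0).trace.re -
        (((r : ℂ) • ρ₀ - ((1 - r : ℝ) : ℂ) • ρ₁) * M 2).trace.re := by
  have h := congrArg (fun X => (ρ₀ * X).trace.re) hM
  simp only [Fin.sum_univ_three, Matrix.mul_add, trace_add, Complex.add_re, Matrix.mul_one, h₀,
    Complex.one_re] at h
  rw [Matrix.sub_mul, trace_sub, smul_mul_assoc, smul_mul_assoc, trace_smul, trace_smul,
    smul_eq_mul, smul_eq_mul, Complex.sub_re, Complex.re_ofReal_mul, Complex.re_ofReal_mul]
  linear_combination r * h

/-- The guessing probability is attained. -/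
theorem exists_isGreatest_guessing (ρ₀ ρ₁ : Matrix ι ι ℂ) (r : ℝ) :
    ∃ g, IsGreatest {x : ℝ | ∃ M : Fin 3 → Matrix ι ι ℂ,
      (∀ i, (M i).PosSemidef) ∧ (∑ i, M i = 1) ∧
        x = r * (ρ₀ * M 1).trace.re + (1 - r) * (ρ₁ * M 2).trace.re} g := by
  obtain ⟨M, hM, hmax⟩ := isCompact_setOf_posSemidef_sum_eq_one.exists_isMaxOn
    ⟨![1, 0, 0], by simp [Fin.forall_fin_succ, PosSemidef.one, PosSemidef.zero,
      Fin.sum_univ_three]⟩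
    (f := fun M => r * (ρ₀ * M 1).trace.re + (1 - r) * (ρ₁ * M 2).trace.re)
    (by fun_prop)
  refine ⟨_, ⟨M, hM.1, hM.2, rfl⟩, ?_⟩
  rintro x ⟨N, hN, hNsum, rfl⟩
  exact hmax ⟨hN, hNsum⟩

/-- Minimum-error discrimination beats guessing the first state iff the weighted difference of
the two states fails to be positive semidefinite. -/
theorem lt_guessing_iff_not_posSemidef {ρ₀ ρ₁ : Matrix ι ι ℂ} (h₀ : IsState ρ₀) (h₁ : IsState ρ₁)
    {r g : ℝ} (hr : 0 ≤ r)
    (hg : IsGreatest {x : ℝ | ∃ M : Fin 3 → Matrix ι ι ℂ,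
      (∀ i, (M i).PosSemidef) ∧ (∑ i, M i = 1) ∧
        x = r * (ρ₀ * M 1).trace.re + (1 - r) * (ρ₁ * M 2).trace.re} g) :
    r < g ↔ ¬ ((r : ℂ) • ρ₀ - ((1 - r : ℝ) : ℂ) • ρ₁).PosSemidef := by
  constructor
  · intro hlt hpos
    obtain ⟨M, hM, hsum, rfl⟩ := hg.1
    rw [guessing_value_eq h₀.2 r hsum] at hlt
    have ha := mul_nonneg hr (Complex.nonneg_iff.mp (h₀.1.trace_mul_nonneg (hM 0))).1
    have hb := (Complex.nonneg_iff.mp (hpos.trace_mul_nonneg (hM 2))).1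
    linarith
  · intro hneg
    have hH : ((r : ℂ) • ρ₀ - ((1 - r : ℝ) : ℂ) • ρ₁).IsHermitian :=
      (h₀.1.isHermitian.smul (Complex.conj_ofReal _)).sub
        (h₁.1.isHermitian.smul (Complex.conj_ofReal _))
    obtain ⟨σ, hσ, hlt⟩ := hH.exists_isState_trace_mul_neg hneg
    have hsum : ∑ i, ![0, 1 - σ, σ] i = 1 := by simp [Fin.sum_univ_three]
    refine lt_of_lt_of_le ?_ (hg.2 ⟨![0, 1 - σ, σ], ?_, hsum, rfl⟩)
    · rw [guessing_value_eq h₀.2 r hsum]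
      simpa using sub_lt_sub_left hlt r
    · simp [Fin.forall_fin_succ, PosSemidef.zero, hσ.posSemidef_one_sub, hσ.1]

/-- Guessing the first state is optimal among separable measurements iff the weighted difference
of the two states is block positive. -/
theorem isGreatest_sep_iff_isBlockPos {m : ℕ} {d : Fin m → ℕ} (hd : ∀ k, 0 < d k)
    {ρ₀ ρ₁ : Matrix (∀ k, Fin (d k)) (∀ k, Fin (d k)) ℂ} (h₀ : IsState ρ₀) (h₁ : IsState ρ₁)
    {r : ℝ} (hr : 0 ≤ r) :
    IsGreatest {x : ℝ | ∃ M : Fin 3 → Matrix (∀ k, Fin (d k)) (∀ k, Fin (d k)) ℂ,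
      (∀ i, IsSep (M i)) ∧ (∑ i, M i = 1) ∧
        x = r * (ρ₀ * M 1).trace.re + (1 - r) * (ρ₁ * M 2).trace.re} r ↔
      IsBlockPos ((r : ℂ) • ρ₀ - ((1 - r : ℝ) : ℂ) • ρ₁) := by
  constructor
  · intro hg
    refine isBlockPos_of_prodMat ((h₀.1.isHermitian.smul (Complex.conj_ofReal _)).sub
        (h₁.1.isHermitian.smul (Complex.conj_ofReal _))) fun σ hσ => ?_
    have hsum : ∑ i, ![0, 1 - prodMat d σ, prodMat d σ] i = 1 := by simp [Fin.sum_univ_three]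
    have hle := hg.2 ⟨![0, 1 - prodMat d σ, prodMat d σ], ?_, hsum, rfl⟩
    · rw [guessing_value_eq h₀.2 r hsum] at hle
      simpa using hle
    · simp [Fin.forall_fin_succ, IsSep.zero, isSep_one_sub_prodMat hd hσ,
        isSep_prodMat hd fun k => (hσ k).1]
  · intro hpos
    refine ⟨⟨![0, 1, 0], ?_, by simp [Fin.sum_univ_three], by simp [h₀.2]⟩, ?_⟩
    · simp [Fin.forall_fin_succ, IsSep.zero, isSep_one hd]
    · rintro x ⟨M, hM, hsum, rfl⟩
      rw [guessing_value_eq h₀.2 r hsum]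
      have ha := mul_nonneg hr
        (Complex.nonneg_iff.mp (h₀.1.trace_mul_nonneg (hM 0).posSemidef)).1
      have hb := (Complex.nonneg_iff.mp (hpos.2 _ (hM 2))).1
      linarith

end TwoStateDiscrimination

theorem isState_sum_smul {ι α : Type*} [Fintype ι] [Fintype α] {η : α → ℝ}
    {ρ : α → Matrix ι ι ℂ} (hη : ∀ i, 0 ≤ η i) (hsum : ∑ i, η i = 1)
    (hρ : ∀ i, IsState (ρ i)) : IsState (∑ i, (η i : ℂ) • ρ i) := by
  refine ⟨posSemidef_sum _ fun i _ => (hρ i).1.smul (by exact_mod_cast hη i), ?_⟩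
  simp only [trace_sum, trace_smul, (hρ _).2, smul_eq_mul, mul_one]
  exact_mod_cast hsum

/-- Theorem 5: `Q j < C j` iff for some `r ∈ (0,1)` the two-state
ensemble `{(r, ρ₀), (1 - r, ρ j)}` satisfies `p_SEP = r < p_G`. -/
theorem nonlocal_confidence_iff_minError_nonlocal
    {m : ℕ} (hm : 2 ≤ m) {d : Fin m → ℕ} (hd : ∀ k, 0 < d k) {n : ℕ}
    (η : Fin n → ℝ) (ρ : Fin n → Matrix (∀ k, Fin (d k)) (∀ k, Fin (d k)) ℂ)
    (hηpos : ∀ i, 0 < η i) (hηsum : ∑ i, η i = 1) (hρ : ∀ i, IsState (ρ i))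
    (j : Fin n) (ρ₀ : Matrix (∀ k, Fin (d k)) (∀ k, Fin (d k)) ℂ)
    (hρ₀ : ρ₀ = ∑ i, (η i : ℂ) • ρ i) (Q C : ℝ)
    (hQ : IsLeast {t : ℝ | IsBlockPos ((t : ℂ) • ρ₀ - (η j : ℂ) • ρ j)} Q)
    (hC : IsLeast {t : ℝ | ((t : ℂ) • ρ₀ - (η j : ℂ) • ρ j).PosSemidef} C) :
    Q < C ↔
      ∃ r g : ℝ, 0 < r ∧ r < 1 ∧
        IsGreatest {x : ℝ |
          ∃ M : Fin 3 → Matrix (∀ k, Fin (d k)) (∀ k, Fin (d k)) ℂ,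
            (∀ i, IsSep (M i)) ∧ (∑ i, M i = 1) ∧
            x = r * ((ρ₀ * M 1).trace.re) + (1 - r) * ((ρ j * M 2).trace.re)} r ∧
        IsGreatest {x : ℝ |
          ∃ M : Fin 3 → Matrix (∀ k, Fin (d k)) (∀ k, Fin (d k)) ℂ,
            (∀ i, (M i).PosSemidef) ∧ (∑ i, M i = 1) ∧
            x = r * ((ρ₀ * M 1).trace.re) + (1 - r) * ((ρ j * M 2).trace.re)} g ∧
        r < g := by
  have h₀ : IsState ρ₀ := hρ₀ ▸ isState_sum_smul (fun i => (hηpos i).le) hηsum hρ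
  have hηj := hηpos j
  constructor
  · intro hlt
    have hQpos : 0 < Q := by
      have h := (Complex.nonneg_iff.mp (hQ.1.2 1 (isSep_one hd))).1
      simp [h₀.2, (hρ j).2] at h
      linarith
    have hs : 0 < Q + η j := by linarith
    have hr1 : Q / (Q + η j) < 1 := by rw [div_lt_one hs]; linarith
    have hscale : ((Q / (Q + η j) : ℝ) : ℂ) • ρ₀ - ((1 - Q / (Q + η j) : ℝ) : ℂ) • ρ j =
        (((Q + η j)⁻¹ : ℝ) : ℂ) • ((Q : ℂ) • ρ₀ - (η j : ℂ) • ρ j) := by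
      rw [smul_sub, smul_smul, smul_smul, ← Complex.ofReal_mul, ← Complex.ofReal_mul]
      congr 3 <;> field_simp
      ring
    have hr0 : 0 < Q / (Q + η j) := div_pos hQpos hs
    obtain ⟨g, hg⟩ := exists_isGreatest_guessing ρ₀ (ρ j) (Q / (Q + η j))
    refine ⟨_, g, hr0, hr1, (isGreatest_sep_iff_isBlockPos hd h₀ (hρ j) hr0.le).mpr ?_, hg,
      (lt_guessing_iff_not_posSemidef h₀ (hρ j) hr0.le hg).mpr fun hpos => ?_⟩
    · rw [hscale]
      exact hQ.1.smul (inv_nonneg.mpr hs.le)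
    · refine hlt.not_ge (hC.2 ?_)
      rw [hscale] at hpos
      have h := hpos.smul (a := ((Q + η j : ℝ) : ℂ)) (by exact_mod_cast hs.le)
      rwa [smul_smul, ← Complex.ofReal_mul, mul_inv_cancel₀ hs.ne', Complex.ofReal_one,
        one_smul] at h
  · rintro ⟨r, g, hr0, hr1, hsep, hg, hlt⟩
    rw [isGreatest_sep_iff_isBlockPos hd h₀ (hρ j) hr0.le] at hsep
    rw [lt_guessing_iff_not_posSemidef h₀ (hρ j) hr0.le hg] at hlt
    have h1r : 0 < 1 - r := by linarith
    set c : ℝ := η j / (1 - r)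
    have hc : 0 < c := div_pos hηj h1r
    have hcη : c * (1 - r) = η j := div_mul_cancel₀ _ h1r.ne'
    refine lt_of_le_of_lt (b := c * r) (hQ.2 ?_) (lt_of_not_ge fun hle => hlt ?_)
    · have h := hsep.smul hc.le
      rwa [smul_sub, smul_smul, smul_smul, ← Complex.ofReal_mul, ← Complex.ofReal_mul, hcη] at h
    · have h : (((c * r : ℝ) : ℂ) • ρ₀ - (η j : ℂ) • ρ j).PosSemidef := by
        have h' := hC.1.add (h₀.1.smul (a := ((c * r - C : ℝ) : ℂ))
          (by exact_mod_cast sub_nonneg.mpr hle))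
        rwa [sub_add_eq_add_sub, ← add_smul, ← Complex.ofReal_add, add_sub_cancel] at h'
      have h' := h.smul (a := ((c⁻¹ : ℝ) : ℂ)) (by exact_mod_cast inv_nonneg.mpr hc.le)
      rwa [smul_sub, smul_smul, smul_smul, ← Complex.ofReal_mul, ← Complex.ofReal_mul, ← hcη,
        inv_mul_cancel_left₀ hc.ne', inv_mul_cancel_left₀ hc.ne'] at h'
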